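/- Let k be a field and A = k[h^{±1}](σ_inv, 1) with σ_inv(h) = h^{-1}. Then every unit of A is of the form α h^i x^j for some α ∈ k^*, i ∈ ℤ, j ∈ ℤ (here x is invertible in A with inverse y, so x^j for negative j means y^{-j}). -/

import Mathlib

open LaurentPolynomial

/-- The defining relations of the degree-one generalized Weyl algebra `k[h^{±1}](σ, a)`:
the generators `Sum.inl p` (for `p` a Laurent polynomial) give a copy of `k[h^{±1}]`,
and the generators `x = Sum.inr 0` and `y = Sum.inr 1` satisfy
`y x = a`, `x y = σ a`, `x r = σ(r) x` and `y r = σ⁻¹(r) y` for all `r ∈ k[h^{±1}]`. -/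
inductive GWARel (k : Type*) [CommRing k] (σ : LaurentPolynomial k ≃ₐ[k] LaurentPolynomial k)
    (a : LaurentPolynomial k) :
    FreeAlgebra k (LaurentPolynomial k ⊕ Fin 2) →
      FreeAlgebra k (LaurentPolynomial k ⊕ Fin 2) → Prop
  | add (r s : LaurentPolynomial k) :
      GWARel k σ a (FreeAlgebra.ι k (Sum.inl (r + s)))
        (FreeAlgebra.ι k (Sum.inl r) + FreeAlgebra.ι k (Sum.inl s))
  | mul (r s : LaurentPolynomial k) :
      GWARel k σ a (FreeAlgebra.ι k (Sum.inl (r * s)))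
        (FreeAlgebra.ι k (Sum.inl r) * FreeAlgebra.ι k (Sum.inl s))
  | smul (c : k) (r : LaurentPolynomial k) :
      GWARel k σ a (FreeAlgebra.ι k (Sum.inl (c • r))) (c • FreeAlgebra.ι k (Sum.inl r))
  | one : GWARel k σ a (FreeAlgebra.ι k (Sum.inl 1)) 1
  | xr (r : LaurentPolynomial k) :
      GWARel k σ a (FreeAlgebra.ι k (Sum.inr 0) * FreeAlgebra.ι k (Sum.inl r))
        (FreeAlgebra.ι k (Sum.inl (σ r)) * FreeAlgebra.ι k (Sum.inr 0))
  | yr (r : LaurentPolynomial k) :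
      GWARel k σ a (FreeAlgebra.ι k (Sum.inr 1) * FreeAlgebra.ι k (Sum.inl r))
        (FreeAlgebra.ι k (Sum.inl (σ.symm r)) * FreeAlgebra.ι k (Sum.inr 1))
  | yx : GWARel k σ a (FreeAlgebra.ι k (Sum.inr 1) * FreeAlgebra.ι k (Sum.inr 0))
        (FreeAlgebra.ι k (Sum.inl a))
  | xy : GWARel k σ a (FreeAlgebra.ι k (Sum.inr 0) * FreeAlgebra.ι k (Sum.inr 1))
        (FreeAlgebra.ι k (Sum.inl (σ a)))

/-- The degree-one generalized Weyl algebra `k[h^{±1}](σ, a)`, presented as the quotient of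
the free algebra on `k[h^{±1}] ⊕ {x, y}` by the generalized Weyl relations. -/
abbrev GWA (k : Type*) [CommRing k] (σ : LaurentPolynomial k ≃ₐ[k] LaurentPolynomial k)
    (a : LaurentPolynomial k) :=
  RingQuot (GWARel k σ a)

namespace GWA

variable {k : Type*} [CommRing k] (σ : LaurentPolynomial k ≃ₐ[k] LaurentPolynomial k)
  (a : LaurentPolynomial k)

/-- The copy of the Laurent polynomial `p` inside the generalized Weyl algebra. -/
noncomputable def r (p : LaurentPolynomial k) : GWA k σ a :=
  RingQuot.mkAlgHom k (GWARel k σ a) (FreeAlgebra.ι k (Sum.inl p))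

/-- The element `h` of the generalized Weyl algebra. -/
noncomputable def H : GWA k σ a := r σ a (T 1)

/-- The element `h⁻¹` of the generalized Weyl algebra. -/
noncomputable def Hinv : GWA k σ a := r σ a (T (-1))

/-- The generator `x` of the generalized Weyl algebra. -/
noncomputable def x : GWA k σ a :=
  RingQuot.mkAlgHom k (GWARel k σ a) (FreeAlgebra.ι k (Sum.inr 0))

/-- The generator `y` of the generalized Weyl algebra. -/
noncomputable def y : GWA k σ a :=
  RingQuot.mkAlgHom k (GWARel k σ a) (FreeAlgebra.ι k (Sum.inr 1))

end GWA

/-- An element `a ∈ k[h^{±1}]` is a monomial if `a = c·hⁱ` for some `c ∈ k`, `i ∈ ℤ`. -/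
def LaurentPolynomial.IsMonomial {k : Type*} [CommRing k] (a : LaurentPolynomial k) : Prop :=
  ∃ (c : k) (i : ℤ), a = C c * T i

/-- The action of the infinite cyclic group on itself in which the generator acts by inversion. -/
noncomputable def inversionAction : Multiplicative ℤ →* MulAut (Multiplicative ℤ) :=
  zpowersHom _ (MulEquiv.inv (Multiplicative ℤ))

/-- The fundamental group `ℤ ⋊ ℤ` of the Klein bottle. -/
abbrev KleinBottleGroup := Multiplicative ℤ ⋊[inversionAction] Multiplicative ℤ

theorem inversionAction_ofAdd_one (n : Multiplicative ℤ) :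
    inversionAction (.ofAdd 1) n = n⁻¹ := by
  simp [inversionAction]

theorem inversionAction_ofAdd_neg_one (n : Multiplicative ℤ) :
    inversionAction (.ofAdd (-1)) n = n⁻¹ := by
  simp [inversionAction, MulAut.inv_def]

/-- The Klein bottle group is right-ordered lexicographically, hence has two unique products. -/
instance : TwoUniqueProds KleinBottleGroup :=
  let _ : LinearOrder KleinBottleGroup :=
    LinearOrder.lift' (fun g : KleinBottleGroup ↦ toLex (g.right, g.left)) fun g₁ g₂ h ↦ by
      have h' := Prod.ext_iff.1 (toLex.injective h)
      exact SemidirectProduct.ext h'.2 h'.1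
  have lt_iff (a b : KleinBottleGroup) :
      a < b ↔ a.right < b.right ∨ a.right = b.right ∧ a.left < b.left := Prod.Lex.toLex_lt_toLex
  have : MulRightStrictMono KleinBottleGroup := ⟨fun c a b h ↦ by
    rw [lt_iff] at h
    change a * c < b * c
    rw [lt_iff]
    rcases h with h | ⟨h, h'⟩
    · exact Or.inl (mul_lt_mul_left h _)
    · refine Or.inr ⟨by simp [h], ?_⟩
      simpa [h] using h'⟩
  TwoUniqueProds.of_covariant_left

/-- Over a domain, the units of the monoid algebra of a monoid with two unique products are
supported on a single element. -/
theorem MonoidAlgebra.exists_eq_single_of_isUnit {R G : Type*} [Semiring R] [NoZeroDivisors R]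
    [Nontrivial R] [Monoid G] [TwoUniqueProds G] {f : MonoidAlgebra R G} (hf : IsUnit f) :
    ∃ (g : G) (c : R), c ≠ 0 ∧ f = MonoidAlgebra.single g c := by
  classical
  obtain ⟨f', hmul, -⟩ := isUnit_iff_exists.1 hf
  have eq_one {a b : G} (ha : a ∈ f.coeff.support) (hb : b ∈ f'.coeff.support)
      (h : UniqueMul f.coeff.support f'.coeff.support a b) : a * b = 1 := by
    by_contra hne
    have key := MonoidAlgebra.coeff_mul_mul_of_uniqueMul h
    rw [hmul, MonoidAlgebra.one_def, MonoidAlgebra.coeff_single,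
      Finsupp.single_eq_of_ne hne] at key
    exact mul_ne_zero (Finsupp.mem_support_iff.1 ha) (Finsupp.mem_support_iff.1 hb) key.symm
  have hcard : f.coeff.support.card * f'.coeff.support.card ≤ 1 := by
    by_contra! h
    obtain ⟨p, hp, q, hq, hpq, hpu, hqu⟩ := TwoUniqueProds.uniqueMul_of_one_lt_card h
    rw [Finset.mem_product] at hp hq
    have := hpu hq.1 hq.2 ((eq_one hq.1 hq.2 hqu).trans (eq_one hp.1 hp.2 hpu).symm)
    exact hpq (Prod.ext this.1.symm this.2.symm)
  have pos {v : MonoidAlgebra R G} (hv : v ≠ 0) : 0 < v.coeff.support.card := by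
    rw [Finset.card_pos, Finsupp.support_nonempty_iff]
    exact fun h ↦ hv (MonoidAlgebra.ext h)
  have h1 : f.coeff.support.card = 1 :=
    le_antisymm ((Nat.le_mul_of_pos_right _ (pos (right_ne_zero_of_mul_eq_one hmul))).trans hcard)
      (pos (left_ne_zero_of_mul_eq_one hmul))
  obtain ⟨g, hg, hfg⟩ := Finsupp.card_support_eq_one.1 h1
  exact ⟨g, f.coeff g, hg, MonoidAlgebra.ext hfg⟩

theorem LaurentPolynomial.algHom_ext_T {k A : Type*} [CommSemiring k] [Semiring A] [Algebra k A]
    {f g : LaurentPolynomial k →ₐ[k] A} (h : f (T 1) = g (T 1)) : f = g :=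
  (AddMonoidAlgebra.lift k A ℤ).symm.injective (MonoidHom.ext_mint h)

theorem LaurentPolynomial.eq_invert {k : Type*} [CommSemiring k]
    {σ : LaurentPolynomial k ≃ₐ[k] LaurentPolynomial k} (hσ : σ (T 1) = T (-1)) : σ = invert :=
  AlgEquiv.coe_toAlgHom_injective (algHom_ext_T (by simpa using hσ))

namespace GWA

section Relations

variable {k : Type*} [CommRing k] (σ : LaurentPolynomial k ≃ₐ[k] LaurentPolynomial k)
  (a : LaurentPolynomial k)

/-- The structure map `k[h^{±1}] → k[h^{±1}](σ, a)` as an algebra homomorphism. -/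
noncomputable def rAlgHom : LaurentPolynomial k →ₐ[k] GWA k σ a :=
  AlgHom.ofLinearMap
    { toFun := r σ a
      map_add' := fun p q ↦ by
        simpa [r] using RingQuot.mkAlgHom_rel k (GWARel.add (σ := σ) (a := a) p q)
      map_smul' := fun c p ↦ by
        simpa [r] using RingQuot.mkAlgHom_rel k (GWARel.smul (σ := σ) (a := a) c p) }
    (by simpa [r] using RingQuot.mkAlgHom_rel k (GWARel.one (σ := σ) (a := a)))
    (fun p q ↦ by simpa [r] using RingQuot.mkAlgHom_rel k (GWARel.mul (σ := σ) (a := a) p q))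

@[simp]
theorem rAlgHom_apply (p : LaurentPolynomial k) : rAlgHom σ a p = r σ a p := rfl

theorem x_mul_r (p : LaurentPolynomial k) : x σ a * r σ a p = r σ a (σ p) * x σ a := by
  simpa [r, x] using RingQuot.mkAlgHom_rel k (GWARel.xr (σ := σ) (a := a) p)

theorem y_mul_x : y σ a * x σ a = r σ a a := by
  simpa [r, x, y] using RingQuot.mkAlgHom_rel k (GWARel.yx (σ := σ) (a := a))

theorem x_mul_y : x σ a * y σ a = r σ a (σ a) := by
  simpa [r, x, y] using RingQuot.mkAlgHom_rel k (GWARel.xy (σ := σ) (a := a))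

/-- The generator `x` as a unit when `a = 1`. -/
noncomputable def xUnit : (GWA k σ 1)ˣ where
  val := x σ 1
  inv := y σ 1
  val_inv := by rw [x_mul_y, map_one, ← rAlgHom_apply, map_one]
  inv_val := by rw [y_mul_x, ← rAlgHom_apply, map_one]

/-- The powers of `h`, as units. -/
noncomputable def hUnit : Multiplicative ℤ →* (GWA k σ a)ˣ :=
  MonoidHom.toHomUnits (((rAlgHom σ a : LaurentPolynomial k →* GWA k σ a)).comp
    (AddMonoidAlgebra.of k ℤ))

theorem coe_hUnit (n : Multiplicative ℤ) :
    (hUnit σ a n : GWA k σ a) = r σ a (T n.toAdd) := rfl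

end Relations

section Inversion

variable (k : Type*) [CommRing k]

/-- The group homomorphism from the Klein bottle group to the units of `k[h^{±1}](σ_inv, 1)`
sending the generators to `h` and `x`. -/
noncomputable def kleinBottleToUnits : KleinBottleGroup →* (GWA k invert 1)ˣ :=
  SemidirectProduct.lift (hUnit invert 1) (zpowersHom _ (xUnit invert)) fun g ↦ by
    have conj_x (n : Multiplicative ℤ) : hUnit (invert (R := k)) 1 n⁻¹ =
        xUnit invert * hUnit invert 1 n * (xUnit invert)⁻¹ := by
      rw [eq_mul_inv_iff_mul_eq]
      ext
      simpa [coe_hUnit, xUnit, -map_inv] using (x_mul_r (invert (R := k)) 1 (T n.toAdd)).symm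
    have conj_zpow (i : ℤ) : ∀ n, hUnit (invert (R := k)) 1 (inversionAction (.ofAdd i) n) =
        xUnit invert ^ i * hUnit invert 1 n * (xUnit invert ^ i)⁻¹ := by
      induction i with
      | zero => simp
      | succ i ih =>
        intro n
        rw [add_comm, ofAdd_add, map_mul, MulAut.mul_apply, inversionAction_ofAdd_one, conj_x, ih]
        group
      | pred i ih =>
        intro n
        have h := conj_x (inversionAction (.ofAdd (-i - 1)) n)
        rw [← inversionAction_ofAdd_one, ← MulAut.mul_apply, ← map_mul, ← ofAdd_add,
          add_sub_cancel, ih] at h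
        rw [eq_mul_inv_iff_mul_eq, ← inv_mul_eq_iff_eq_mul] at h
        rw [← h]
        group
    exact MonoidHom.ext fun n ↦ conj_zpow g.toAdd n

/-- The inclusion of `k[h^{±1}]` in the group algebra of the Klein bottle group. -/
noncomputable def laurentToGroupAlgebra :
    LaurentPolynomial k →ₐ[k] MonoidAlgebra k KleinBottleGroup :=
  AddMonoidAlgebra.lift k _ ℤ ((MonoidAlgebra.of k KleinBottleGroup).comp SemidirectProduct.inl)

theorem laurentToGroupAlgebra_single (n : ℤ) (c : k) :
    laurentToGroupAlgebra k (AddMonoidAlgebra.single n c) =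
      MonoidAlgebra.single (SemidirectProduct.inl (.ofAdd n)) c := by
  simp [laurentToGroupAlgebra, AddMonoidAlgebra.lift_single, -single_eq_C_mul_T]

theorem single_inr_mul_laurentToGroupAlgebra {g : Multiplicative ℤ}
    (hg : ∀ n, inversionAction g n = n⁻¹) (p : LaurentPolynomial k) :
    MonoidAlgebra.single (SemidirectProduct.inr g) 1 * laurentToGroupAlgebra k p =
      laurentToGroupAlgebra k (invert p) * MonoidAlgebra.single (SemidirectProduct.inr g) 1 := by
  induction p using LaurentPolynomial.induction_on' with
  | add p q hp hq => simp only [map_add, mul_add, add_mul, hp, hq]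
  | C_mul_T n c =>
    rw [map_mul invert, invert_C, invert_T, ← single_eq_C_mul_T, ← single_eq_C_mul_T,
      laurentToGroupAlgebra_single, laurentToGroupAlgebra_single,
      MonoidAlgebra.single_mul_single, MonoidAlgebra.single_mul_single, one_mul, mul_one]
    congr 1
    ext <;> simp [hg]

/-- The algebra homomorphism from `k[h^{±1}](σ_inv, 1)` to the group algebra of the Klein bottle
group sending `h` and `x` to the generators. -/
noncomputable def toGroupAlgebra : GWA k invert 1 →ₐ[k] MonoidAlgebra k KleinBottleGroup :=
  RingQuot.liftAlgHom k ⟨FreeAlgebra.lift k (Sum.elim (laurentToGroupAlgebra k)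
      ![MonoidAlgebra.single (SemidirectProduct.inr (.ofAdd 1)) 1,
        MonoidAlgebra.single (SemidirectProduct.inr (.ofAdd (-1))) 1]), by
    rintro _ _ (⟨p, q⟩ | ⟨p, q⟩ | ⟨c, p⟩ | _ | p | p | _ | _)
    · simp
    · simp
    · simp
    · simp
    · simpa using single_inr_mul_laurentToGroupAlgebra k inversionAction_ofAdd_one p
    · simpa using single_inr_mul_laurentToGroupAlgebra k inversionAction_ofAdd_neg_one p
    · simp [MonoidAlgebra.single_mul_single, MonoidAlgebra.one_def]
    · simp [MonoidAlgebra.single_mul_single, MonoidAlgebra.one_def]⟩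

theorem toGroupAlgebra_r (p : LaurentPolynomial k) :
    toGroupAlgebra k (r invert 1 p) = laurentToGroupAlgebra k p := by
  simp [toGroupAlgebra, r, RingQuot.liftAlgHom_mkAlgHom_apply]

theorem toGroupAlgebra_x : toGroupAlgebra k (x invert 1) =
    MonoidAlgebra.single (SemidirectProduct.inr (.ofAdd 1)) 1 := by
  simp [toGroupAlgebra, x, RingQuot.liftAlgHom_mkAlgHom_apply]

theorem toGroupAlgebra_y : toGroupAlgebra k (y invert 1) =
    MonoidAlgebra.single (SemidirectProduct.inr (.ofAdd (-1))) 1 := by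
  simp [toGroupAlgebra, y, RingQuot.liftAlgHom_mkAlgHom_apply]

/-- The algebra homomorphism from the group algebra of the Klein bottle group to
`k[h^{±1}](σ_inv, 1)` sending the generators to `h` and `x`. -/
noncomputable def ofGroupAlgebra : MonoidAlgebra k KleinBottleGroup →ₐ[k] GWA k invert 1 :=
  MonoidAlgebra.lift k _ _ ((Units.coeHom _).comp (kleinBottleToUnits k))

theorem ofGroupAlgebra_single (g : KleinBottleGroup) (c : k) :
    ofGroupAlgebra k (MonoidAlgebra.single g c) =
      algebraMap k (GWA k invert 1) c * r invert 1 (T g.left.toAdd) *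
        ((xUnit invert ^ g.right.toAdd : (GWA k invert 1)ˣ) : GWA k invert 1) := by
  simp [ofGroupAlgebra, kleinBottleToUnits, SemidirectProduct.lift, coe_hUnit,
    Algebra.smul_def, mul_assoc]

theorem ofGroupAlgebra_comp_toGroupAlgebra :
    (ofGroupAlgebra k).comp (toGroupAlgebra k) = AlgHom.id k _ := by
  have h_r : ((ofGroupAlgebra k).comp (laurentToGroupAlgebra k)) = rAlgHom invert 1 := by
    refine algHom_ext_T ?_
    rw [AlgHom.comp_apply, T, laurentToGroupAlgebra_single, ofGroupAlgebra_single]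
    simp
  refine RingQuot.ringQuot_ext' k _ _ (FreeAlgebra.hom_ext (funext ?_))
  rintro (p | i)
  · change ofGroupAlgebra k (toGroupAlgebra k (r invert 1 p)) = r invert 1 p
    rw [toGroupAlgebra_r]
    exact AlgHom.congr_fun h_r p
  · fin_cases i
    · change ofGroupAlgebra k (toGroupAlgebra k (x invert 1)) = x invert 1
      rw [toGroupAlgebra_x, ofGroupAlgebra_single]
      simp [← rAlgHom_apply, xUnit]
    · change ofGroupAlgebra k (toGroupAlgebra k (y invert 1)) = y invert 1
      rw [toGroupAlgebra_y, ofGroupAlgebra_single]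
      simp [← rAlgHom_apply, xUnit]

end Inversion

end GWA

/-- In `A = k[h^{±1}](σ_inv, 1)` with `σ_inv(h) = h⁻¹`, every unit of `A`
is of the form `α hⁱ xʲ` with `α ∈ k^*` and `i, j ∈ ℤ` (negative powers of `x` being powers
of `y = x⁻¹`). -/
theorem units_involution_gwa_one (k : Type*) [Field k]
    (σ : LaurentPolynomial k ≃ₐ[k] LaurentPolynomial k) (hσ : σ (T 1) = T (-1))
    (u : (GWA k σ 1)ˣ) :
    ∃ (α : k) (i j : ℤ) (hx : IsUnit (GWA.x σ 1)), α ≠ 0 ∧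
      (u : GWA k σ 1) =
        algebraMap k (GWA k σ 1) α * GWA.r σ 1 (T i) * ((hx.unit ^ j : (GWA k σ 1)ˣ) : GWA k σ 1) := by
  obtain rfl := eq_invert hσ
  obtain ⟨g, α, hα, hg⟩ :=
    MonoidAlgebra.exists_eq_single_of_isUnit (u.isUnit.map (GWA.toGroupAlgebra k))
  have hx : IsUnit (GWA.x (invert (R := k)) 1) := (GWA.xUnit invert).isUnit
  have hx_unit : hx.unit = GWA.xUnit invert := Units.ext rfl
  refine ⟨α, g.left.toAdd, g.right.toAdd, hx, hα, ?_⟩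
  rw [hx_unit, ← GWA.ofGroupAlgebra_single, ← hg]
  exact (AlgHom.congr_fun (GWA.ofGroupAlgebra_comp_toGroupAlgebra k) (u : GWA k invert 1)).symm
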